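/- arXiv:2405.12421 — 2 statements merged into one kernel-verified Lean document; each statement's English description precedes it below -/
import Mathlib

section
/- Let α, β ∈ (0,1) be real numbers with α > 2e³β. Define J : ℝ³ → ℝ by J(θ₁,θ₂,θ₃) = α·log(exp(θ₂)/(exp(θ₁)+exp(θ₂))) + β·log(exp(θ₃)/(exp(θ₂)+exp(θ₃))), and let Θ = {θ ∈ ℝ³ : θ₁+θ₂+θ₃ = 0 and θ₁²+θ₂²+θ₃² ≤ 1}. Then every θ* ∈ Θ that maximizes J over Θ (i.e., J(θ*) ≥ J(θ) for all θ ∈ Θ) satisfies θ*₂ > θ*₃. -/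
/-- The log-likelihood of a Bradley–Terry–Luce comparison depends only on the reward gap. -/
theorem log_btl_eq (a b : ℝ) :
    Real.log (Real.exp b / (Real.exp a + Real.exp b)) = -Real.log (1 + Real.exp (a - b)) := by
  rw [← Real.log_inv, Real.exp_sub]
  congr 1
  field_simp
  ring

theorem exp_seven_fortieths_lt : Real.exp (7 / 40) < 1.192 := by
  refine lt_of_pow_lt_pow_left₀ 40 (by norm_num) ?_
  calc Real.exp (7 / 40) ^ 40 = Real.exp 1 ^ 7 := by
        rw [← Real.exp_nat_mul, ← Real.exp_nat_mul]; norm_num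
    _ < 2.7182818286 ^ 7 := by gcongr; exact Real.exp_one_lt_d9
    _ < 1.192 ^ 40 := by norm_num

theorem log_one_add_exp_seven_tenths_le : Real.log (1 + Real.exp (7 / 10)) ≤ 6 / 5 := by
  rw [Real.log_le_iff_le_exp (by positivity)]
  have hpow : Real.exp (7 / 10) = Real.exp (7 / 40) ^ 4 := by
    rw [← Real.exp_nat_mul]; norm_num
  have hlt : Real.exp (7 / 40) ^ 4 < 1.192 ^ 4 := by
    gcongr; exact exp_seven_fortieths_lt
  have hsplit : Real.exp (6 / 5) = Real.exp 1 * Real.exp (1 / 5) := by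
    rw [← Real.exp_add]; norm_num
  have hone := Real.exp_one_gt_d9
  have hfifth := Real.add_one_le_exp (1 / 5 : ℝ)
  rw [hpow, hsplit]
  nlinarith

theorem log_one_add_exp_gap :
    0.033 ≤ Real.log (1 + Real.exp (-(49 / 40))) - Real.log (1 + Real.exp (-(7 / 5))) := by
  set t := Real.exp (7 / 40) with ht
  have hlow : 47 / 40 ≤ t := by
    have := Real.add_one_le_exp (7 / 40 : ℝ); linarith
  have hpos : 0 < t := by linarith
  have h₇ : Real.exp (-(49 / 40)) = (t ^ 7)⁻¹ := by
    rw [ht, ← Real.exp_nat_mul, ← Real.exp_neg]; norm_num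
  have h₈ : Real.exp (-(7 / 5)) = (t ^ 8)⁻¹ := by
    rw [ht, ← Real.exp_nat_mul, ← Real.exp_neg]; norm_num
  have hpow : t ^ 8 < 1.192 ^ 8 := by gcongr; exact exp_seven_fortieths_lt
  have hlog := Real.one_sub_inv_le_log_of_pos
    (show 0 < (1 + (t ^ 7)⁻¹) / (1 + (t ^ 8)⁻¹) by positivity)
  rw [Real.log_div (by positivity) (by positivity)] at hlog
  have hquot : 1 - ((1 + (t ^ 7)⁻¹) / (1 + (t ^ 8)⁻¹))⁻¹ = (t - 1) / (t ^ 8 + t) := by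
    field_simp
    ring
  rw [h₇, h₈]
  refine le_trans ?_ (hquot ▸ hlog)
  rw [le_div_iff₀ (by positivity)]
  have := exp_seven_fortieths_lt
  norm_num at hpow this ⊢
  linarith

theorem exp_three_gt : 20 < Real.exp 3 := by
  calc (20 : ℝ) < 2.7182818283 ^ 3 := by norm_num
    _ < Real.exp 1 ^ 3 := by gcongr; exact Real.exp_one_gt_d9
    _ = Real.exp 3 := by rw [← Real.exp_nat_mul]; norm_num

/-- Lemma 2 of the paper: for `α, β ∈ (0,1)` with `α > 2e³β`, any maximizer over
`Θ = {θ : θ₁+θ₂+θ₃ = 0, θ₁²+θ₂²+θ₃² ≤ 1}` of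
`J(θ) = α·log(exp θ₂/(exp θ₁ + exp θ₂)) + β·log(exp θ₃/(exp θ₂ + exp θ₃))`
satisfies `θ₂ > θ₃`. -/
theorem mle_ranking_lemma (α β : ℝ) (hα : α ∈ Set.Ioo (0 : ℝ) 1) (hβ : β ∈ Set.Ioo (0 : ℝ) 1)
    (hαβ : α > 2 * Real.exp 3 * β) (θ : Fin 3 → ℝ)
    (hθsum : θ 0 + θ 1 + θ 2 = 0) (hθnorm : (θ 0) ^ 2 + (θ 1) ^ 2 + (θ 2) ^ 2 ≤ 1)
    (hmax : ∀ η : Fin 3 → ℝ, η 0 + η 1 + η 2 = 0 → (η 0) ^ 2 + (η 1) ^ 2 + (η 2) ^ 2 ≤ 1 →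
      α * Real.log (Real.exp (η 1) / (Real.exp (η 0) + Real.exp (η 1))) +
          β * Real.log (Real.exp (η 2) / (Real.exp (η 1) + Real.exp (η 2))) ≤
        α * Real.log (Real.exp (θ 1) / (Real.exp (θ 0) + Real.exp (θ 1))) +
          β * Real.log (Real.exp (θ 2) / (Real.exp (θ 1) + Real.exp (θ 2)))) :
    θ 1 > θ 2 := by
  by_contra! hle
  have hgap : θ 1 - θ 0 ≤ 49 / 40 := by
    by_contra! hlt
    have hθ₂ : θ 2 = -θ 0 - θ 1 := by linarith
    rw [hθ₂] at hθnorm hle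
    nlinarith [mul_nonneg (by linarith : 0 ≤ θ 1 - θ 0) (by linarith : 0 ≤ -θ 0 - θ 1 - θ 1)]
  have hcmp := hmax ![-(7 / 10), 7 / 10, 0] (by simp) (by norm_num [Matrix.cons_val_two])
  simp only [log_btl_eq, Matrix.cons_val] at hcmp
  rw [show (-(7 / 10) - 7 / 10 : ℝ) = -(7 / 5) by norm_num, sub_zero] at hcmp
  have hmono : Real.log (1 + Real.exp (-(49 / 40))) ≤ Real.log (1 + Real.exp (θ 0 - θ 1)) := by
    gcongr
    linarith
  have hnonneg : 0 ≤ Real.log (1 + Real.exp (θ 1 - θ 2)) :=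
    Real.log_nonneg (by linarith [Real.exp_pos (θ 1 - θ 2)])
  have hgain : α * 0.033 ≤
      α * (Real.log (1 + Real.exp (θ 0 - θ 1)) - Real.log (1 + Real.exp (-(7 / 5)))) :=
    mul_le_mul_of_nonneg_left (by linarith [log_one_add_exp_gap]) hα.1.le
  have hloss := mul_le_mul_of_nonneg_left log_one_add_exp_seven_tenths_le hβ.1.le
  have hrest := mul_nonneg hβ.1.le hnonneg
  have hratio := mul_lt_mul_of_pos_right exp_three_gt hβ.1
  linarith [hβ.1]
end

section
/- Let θ₁, θ₂, θ₃ ∈ ℝ satisfy θ₁ + θ₂ + θ₃ = 0 and θ₂ ≤ 1, and let α, β ∈ ℝ satisfy β > 0 and α > 2e³β. Then α·exp(θ₁)/(exp(θ₁)+exp(θ₂)) − 2β·exp(θ₂)/(exp(θ₂)+exp(θ₃)) > 0. -/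
/-- The key strict inequality in the proof of Lemma 2: if `θ₁ + θ₂ + θ₃ = 0`, `θ₂ ≤ 1`,
`β > 0`, and `α > 2e³β`, then
`α·exp θ₁/(exp θ₁ + exp θ₂) − 2β·exp θ₂/(exp θ₂ + exp θ₃) > 0`. -/
theorem mle_key_inequality (θ₁ θ₂ θ₃ α β : ℝ) (hsum : θ₁ + θ₂ + θ₃ = 0) (hθ₂ : θ₂ ≤ 1)
    (hβ : β > 0) (hαβ : α > 2 * Real.exp 3 * β) :
    α * Real.exp θ₁ / (Real.exp θ₁ + Real.exp θ₂) -
      2 * β * Real.exp θ₂ / (Real.exp θ₂ + Real.exp θ₃) > 0 := by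
  have hab : Real.exp θ₂ * Real.exp θ₁ ≤ Real.exp 3 * (Real.exp θ₁ * Real.exp θ₂) := by
    rw [← Real.exp_add, ← Real.exp_add, ← Real.exp_add]
    exact Real.exp_le_exp.2 (by linarith)
  have hbb : Real.exp θ₂ * Real.exp θ₂ ≤ Real.exp 3 * (Real.exp θ₁ * Real.exp θ₃) := by
    rw [← Real.exp_add, ← Real.exp_add, ← Real.exp_add]
    exact Real.exp_le_exp.2 (by linarith)
  rw [gt_iff_lt, sub_pos, div_lt_div_iff₀ (by positivity) (by positivity)]
  calc 2 * β * Real.exp θ₂ * (Real.exp θ₁ + Real.exp θ₂)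
      = 2 * β * (Real.exp θ₂ * Real.exp θ₁ + Real.exp θ₂ * Real.exp θ₂) := by ring
    _ ≤ 2 * β * (Real.exp 3 * (Real.exp θ₁ * Real.exp θ₂) +
          Real.exp 3 * (Real.exp θ₁ * Real.exp θ₃)) := by gcongr
    _ = 2 * Real.exp 3 * β * (Real.exp θ₁ * (Real.exp θ₂ + Real.exp θ₃)) := by ring
    _ < α * (Real.exp θ₁ * (Real.exp θ₂ + Real.exp θ₃)) :=
        mul_lt_mul_of_pos_right hαβ (by positivity)
    _ = α * Real.exp θ₁ * (Real.exp θ₂ + Real.exp θ₃) := by ring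
end
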